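/- arXiv:1211.7325 — 5 statements merged into one kernel-verified Lean document; each statement's English description precedes it below -/
import Mathlib

section
/- For all real ν ≥ 1/2 and all x > 0, ∫_0^x t^ν I_ν(t) dt < x^ν I_ν(x). -/
open Real MeasureTheory

/-- The modified Bessel function of the first kind
`I_ν(x) = Σ_{k=0}^∞ (1/(k! Γ(k+ν+1))) (x/2)^{2k+ν}`. -/
noncomputable def besselI (ν x : ℝ) : ℝ :=
  ∑' k : ℕ, (1 / ((k.factorial : ℝ) * Real.Gamma ((k : ℝ) + ν + 1))) *
    (x / 2) ^ (2 * (k : ℝ) + ν)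

/-- The coefficient of `t ^ (2 * k + 2 * ν)` in the expansion of `t ^ ν * besselI ν t`. -/
noncomputable def besselCoeff (ν : ℝ) (k : ℕ) : ℝ :=
  1 / ((k.factorial : ℝ) * Real.Gamma ((k : ℝ) + ν + 1)) * (1 / 2) ^ (2 * (k : ℝ) + ν)

lemma rpow_mul_besselI {ν t : ℝ} (hν : 0 ≤ ν) (ht : 0 ≤ t) :
    t ^ ν * besselI ν t = ∑' k : ℕ, besselCoeff ν k * t ^ (2 * (k : ℝ) + 2 * ν) := by
  rw [besselI, ← tsum_mul_left]
  refine tsum_congr fun k => ?_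
  have hk : (0 : ℝ) ≤ 2 * (k : ℝ) + ν := by positivity
  rw [div_eq_mul_one_div t 2, mul_rpow ht (by norm_num),
    show 2 * (k : ℝ) + 2 * ν = ν + (2 * (k : ℝ) + ν) by ring, rpow_add_of_nonneg ht hν hk,
    besselCoeff]
  ring

lemma besselCoeff_pos {ν : ℝ} (hν : 0 ≤ ν) (k : ℕ) : 0 < besselCoeff ν k := by
  have : 0 < Real.Gamma ((k : ℝ) + ν + 1) := Real.Gamma_pos_of_pos (by positivity)
  unfold besselCoeff
  positivity

lemma besselCoeff_succ {ν : ℝ} (hν : 0 ≤ ν) (k : ℕ) :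
    besselCoeff ν (k + 1) = besselCoeff ν k / (4 * ((k : ℝ) + 1) * ((k : ℝ) + 1 + ν)) := by
  have hk : (0 : ℝ) < (k : ℝ) + ν + 1 := by positivity
  have hG : Real.Gamma ((k : ℝ) + ν + 1) ≠ 0 := (Real.Gamma_pos_of_pos hk).ne'
  have hk' : (k : ℝ) + 1 + ν ≠ 0 := by positivity
  unfold besselCoeff
  push_cast
  rw [show (k : ℝ) + 1 + ν + 1 = ((k : ℝ) + ν + 1) + 1 by ring, Real.Gamma_add_one hk.ne',
    show 2 * ((k : ℝ) + 1) + ν = (2 * (k : ℝ) + ν) + (2 : ℕ) by push_cast; ring,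
    rpow_add_natCast (by norm_num), Nat.factorial_succ,
    show (k : ℝ) + ν + 1 = (k : ℝ) + 1 + ν by ring]
  rw [show (k : ℝ) + ν + 1 = (k : ℝ) + 1 + ν by ring] at hG
  push_cast
  field_simp
  norm_num

lemma besselCoeff_mul_le {ν : ℝ} (hν : 1 / 2 ≤ ν) (k : ℕ) :
    besselCoeff ν k * (2 * (k : ℝ) + 2 * ν) ≤
      besselCoeff ν 0 * (2 * ν) * ((1 / 2) ^ k / (k.factorial : ℝ)) := by
  have hν0 : 0 ≤ ν := by linarith
  induction k with
  | zero => simp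
  | succ k ih =>
    have ha := besselCoeff_pos hν0 k
    have hk : (0 : ℝ) ≤ k := k.cast_nonneg
    have hk' : (k : ℝ) + 1 + ν ≠ 0 := by positivity
    have hstep : besselCoeff ν (k + 1) * (2 * ((k + 1 : ℕ) : ℝ) + 2 * ν) ≤
        besselCoeff ν k * (2 * (k : ℝ) + 2 * ν) * ((1 / 2) / ((k : ℝ) + 1)) := by
      rw [besselCoeff_succ hν0]
      push_cast
      have : besselCoeff ν k / (4 * ((k : ℝ) + 1) * ((k : ℝ) + 1 + ν)) *
          (2 * ((k : ℝ) + 1) + 2 * ν) = besselCoeff ν k * 1 * ((1 / 2) / ((k : ℝ) + 1)) := by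
        field_simp
        ring
      rw [this]
      gcongr
      linarith
    refine hstep.trans ?_
    calc _ ≤ besselCoeff ν 0 * (2 * ν) * ((1 / 2) ^ k / (k.factorial : ℝ)) *
          ((1 / 2) / ((k : ℝ) + 1)) := by gcongr
      _ = _ := by
        rw [Nat.factorial_succ, pow_succ]
        push_cast
        field_simp

lemma summable_besselCoeff_deriv {ν R : ℝ} (hν : 1 / 2 ≤ ν) (hR : 0 < R) :
    Summable fun k : ℕ => besselCoeff ν k *
      ((2 * (k : ℝ) + 2 * ν) * R ^ (2 * (k : ℝ) + 2 * ν - 1)) := by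
  have hν0 : 0 ≤ ν := by linarith
  refine Summable.of_nonneg_of_le (fun k => ?_) (fun k => ?_)
    ((Real.summable_pow_div_factorial (R ^ 2 / 2)).mul_left
      (besselCoeff ν 0 * (2 * ν) * R ^ (2 * ν - 1)))
  · have := besselCoeff_pos hν0 k
    positivity
  · have h : R ^ (2 * (k : ℝ) + 2 * ν - 1) = (R ^ 2) ^ k * R ^ (2 * ν - 1) := by
      rw [show 2 * (k : ℝ) + 2 * ν - 1 = ((2 * k : ℕ) : ℝ) + (2 * ν - 1) by push_cast; ring,
        rpow_add hR, rpow_natCast, pow_mul]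
    rw [h, ← mul_assoc]
    calc _ ≤ besselCoeff ν 0 * (2 * ν) * ((1 / 2) ^ k / (k.factorial : ℝ)) *
          ((R ^ 2) ^ k * R ^ (2 * ν - 1)) :=
            mul_le_mul_of_nonneg_right (besselCoeff_mul_le hν k) (by positivity)
      _ = _ := by rw [div_pow, div_pow]; ring

lemma summable_besselCoeff {ν R : ℝ} (hν : 1 / 2 ≤ ν) (hR : 0 < R) :
    Summable fun k : ℕ => besselCoeff ν k * R ^ (2 * (k : ℝ) + 2 * ν) := by
  have hν0 : 0 ≤ ν := by linarith
  refine Summable.of_nonneg_of_le (fun k => ?_) (fun k => ?_)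
    ((summable_besselCoeff_deriv hν hR).mul_left R)
  · have := besselCoeff_pos hν0 k
    positivity
  · have ha := besselCoeff_pos hν0 k
    have hk : (0 : ℝ) ≤ k := k.cast_nonneg
    rw [rpow_sub_one hR.ne']
    have : R * (besselCoeff ν k * ((2 * (k : ℝ) + 2 * ν) * (R ^ (2 * (k : ℝ) + 2 * ν) / R))) =
        (2 * (k : ℝ) + 2 * ν) * (besselCoeff ν k * R ^ (2 * (k : ℝ) + 2 * ν)) := by
      field_simp
    rw [this]
    exact le_mul_of_one_le_left (by positivity) (by linarith)

lemma summable_besselCoeff_integral {ν R : ℝ} (hν : 1 / 2 ≤ ν) (hR : 0 < R) :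
    Summable fun k : ℕ => besselCoeff ν k / (2 * (k : ℝ) + 2 * ν + 1) *
      R ^ (2 * (k : ℝ) + 2 * ν + 1) := by
  have hν0 : 0 ≤ ν := by linarith
  refine Summable.of_nonneg_of_le (fun k => ?_) (fun k => ?_)
    ((summable_besselCoeff hν hR).mul_left R)
  · have := besselCoeff_pos hν0 k
    positivity
  · have ha := besselCoeff_pos hν0 k
    have hk : (0 : ℝ) ≤ k := k.cast_nonneg
    rw [rpow_add_one hR.ne']
    calc _ ≤ besselCoeff ν k * (R ^ (2 * (k : ℝ) + 2 * ν) * R) := by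
          gcongr
          exact div_le_self ha.le (by linarith)
      _ = _ := by ring

lemma continuousOn_tsum_mul_rpow {c e : ℕ → ℝ} {R : ℝ} (hc : ∀ k, 0 ≤ c k) (he : ∀ k, 0 ≤ e k)
    (hs : Summable fun k => c k * R ^ e k) :
    ContinuousOn (fun t : ℝ => ∑' k, c k * t ^ e k) (Set.Icc 0 R) := by
  refine continuousOn_tsum (fun k => ?_) hs fun k t ht => ?_
  · exact continuousOn_const.mul (continuousOn_id.rpow_const fun _ _ => Or.inr (he k))
  · rw [Real.norm_of_nonneg (mul_nonneg (hc k) (rpow_nonneg ht.1 _))]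
    exact mul_le_mul_of_nonneg_left (rpow_le_rpow ht.1 ht.2 (he k)) (hc k)

lemma hasDerivAt_tsum_mul_rpow {c e : ℕ → ℝ} {R t : ℝ} (hc : ∀ k, 0 ≤ c k) (he : ∀ k, 1 ≤ e k)
    (hs : ∀ r > 0, Summable fun k => c k * r ^ e k)
    (hs' : Summable fun k => c k * (e k * R ^ (e k - 1))) (ht : t ∈ Set.Ioo 0 R) :
    HasDerivAt (fun t : ℝ => ∑' k, c k * t ^ e k) (∑' k, c k * (e k * t ^ (e k - 1))) t := by
  refine hasDerivAt_tsum_of_isPreconnected (g := fun k t => c k * t ^ e k)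
    (g' := fun k t => c k * (e k * t ^ (e k - 1))) hs' isOpen_Ioo isPreconnected_Ioo
    (fun k y hy => ?_) (fun k y hy => ?_) ht (hs t ht.1) ht
  · exact (Real.hasDerivAt_rpow_const (Or.inl hy.1.ne')).const_mul _
  · have he0 : 0 ≤ e k := by linarith [he k]
    have hy0 : 0 ≤ y := hy.1.le
    rw [Real.norm_of_nonneg (mul_nonneg (hc k) (mul_nonneg he0 (rpow_nonneg hy0 _)))]
    exact mul_le_mul_of_nonneg_left (mul_le_mul_of_nonneg_left
      (rpow_le_rpow hy0 hy.2.le (by linarith [he k])) he0) (hc k)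

lemma tsum_besselCoeff_integral_lt_deriv {ν t : ℝ} (hν : 1 / 2 ≤ ν) (ht : 0 < t) :
    ∑' k : ℕ, besselCoeff ν k / (2 * (k : ℝ) + 2 * ν + 1) * t ^ (2 * (k : ℝ) + 2 * ν + 1) <
      ∑' k : ℕ, besselCoeff ν k * ((2 * (k : ℝ) + 2 * ν) * t ^ (2 * (k : ℝ) + 2 * ν - 1)) := by
  have hν0 : 0 < ν := by linarith
  have hd := summable_besselCoeff_deriv hν ht
  rw [hd.tsum_eq_zero_add]
  refine (Summable.tsum_le_tsum (fun k => ?_) (summable_besselCoeff_integral hν ht)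
    ((summable_nat_add_iff 1).2 hd)).trans_lt (lt_add_of_pos_left _ ?_)
  · have ha := besselCoeff_pos hν0.le k
    have hk : (0 : ℝ) ≤ k := k.cast_nonneg
    rw [besselCoeff_succ hν0.le]
    push_cast
    rw [show 2 * ((k : ℝ) + 1) + 2 * ν - 1 = 2 * (k : ℝ) + 2 * ν + 1 by ring, ← mul_assoc]
    have : besselCoeff ν k / (4 * ((k : ℝ) + 1) * ((k : ℝ) + 1 + ν)) *
        (2 * ((k : ℝ) + 1) + 2 * ν) = besselCoeff ν k / (2 * (k : ℝ) + 2) := by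
      have hk' : (k : ℝ) + 1 + ν ≠ 0 := by positivity
      field_simp
      ring
    rw [this]
    gcongr ?_ * _
    gcongr besselCoeff ν k / ?_
    linarith
  · have := besselCoeff_pos hν0.le 0
    positivity

theorem integral_besselI_upper_bound (ν : ℝ) (hν : 1 / 2 ≤ ν) (x : ℝ) (hx : 0 < x) :
    (∫ t in (0 : ℝ)..x, t ^ ν * besselI ν t) < x ^ ν * besselI ν x := by
  have hν0 : 0 < ν := by linarith
  set f : ℝ → ℝ := fun t => ∑' k : ℕ, besselCoeff ν k * t ^ (2 * (k : ℝ) + 2 * ν) with hf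
  set F : ℝ → ℝ := fun t => ∑' k : ℕ, besselCoeff ν k / (2 * (k : ℝ) + 2 * ν + 1) *
    t ^ (2 * (k : ℝ) + 2 * ν + 1) with hF
  have hf_cont : ContinuousOn f (Set.Icc 0 x) :=
    continuousOn_tsum_mul_rpow (fun k => (besselCoeff_pos hν0.le k).le) (fun k => by positivity)
      (summable_besselCoeff hν hx)
  have hc : ∀ k : ℕ, 0 ≤ besselCoeff ν k / (2 * (k : ℝ) + 2 * ν + 1) := fun k =>
    div_nonneg (besselCoeff_pos hν0.le k).le (by positivity)
  have hF_cont : ContinuousOn F (Set.Icc 0 x) :=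
    continuousOn_tsum_mul_rpow hc (fun k => by positivity) (summable_besselCoeff_integral hν hx)
  have hf_deriv : ∀ t ∈ Set.Ioo 0 x, HasDerivAt f (∑' k : ℕ, besselCoeff ν k *
      ((2 * (k : ℝ) + 2 * ν) * t ^ (2 * (k : ℝ) + 2 * ν - 1))) t := fun t ht =>
    hasDerivAt_tsum_mul_rpow (fun k => (besselCoeff_pos hν0.le k).le)
      (fun k => by linarith [k.cast_nonneg (α := ℝ)]) (fun r hr => summable_besselCoeff hν hr)
      (summable_besselCoeff_deriv hν hx) ht
  have hterm : ∀ (t : ℝ) (k : ℕ), besselCoeff ν k / (2 * (k : ℝ) + 2 * ν + 1) *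
      ((2 * (k : ℝ) + 2 * ν + 1) * t ^ (2 * (k : ℝ) + 2 * ν + 1 - 1)) =
        besselCoeff ν k * t ^ (2 * (k : ℝ) + 2 * ν) := fun t k => by
    rw [add_sub_cancel_right, ← mul_assoc, div_mul_cancel₀ _ (by positivity)]
  have hF_deriv : ∀ t ∈ Set.Ioo 0 x, HasDerivAt F (f t) t := fun t ht => by
    have h := hasDerivAt_tsum_mul_rpow (e := fun k : ℕ => 2 * (k : ℝ) + 2 * ν + 1) hc
      (fun k => by linarith [k.cast_nonneg (α := ℝ)])
      (fun r hr => summable_besselCoeff_integral hν hr)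
      ((summable_besselCoeff hν hx).congr fun k => (hterm x k).symm) ht
    simpa only [hterm] using h
  have hf_zero : f 0 = 0 := by
    have (k : ℕ) : (0 : ℝ) ^ (2 * (k : ℝ) + 2 * ν) = 0 := zero_rpow (by positivity)
    simp [hf, this]
  have hF_zero : F 0 = 0 := by
    have (k : ℕ) : (0 : ℝ) ^ (2 * (k : ℝ) + 2 * ν + 1) = 0 := zero_rpow (by positivity)
    simp [hF, this]
  have hint : ∫ t in (0 : ℝ)..x, t ^ ν * besselI ν t = F x := by
    rw [intervalIntegral.integral_congr (g := f) fun t ht => rpow_mul_besselI hν0.le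
      (Set.uIcc_of_le hx.le ▸ ht).1, intervalIntegral.integral_eq_sub_of_hasDerivAt_of_le hx.le
      hF_cont hF_deriv (hf_cont.intervalIntegrable_of_Icc hx.le), hF_zero, sub_zero]
  rw [hint, rpow_mul_besselI hν0.le hx.le]
  have hmono : StrictMonoOn (fun t => Real.exp t * (f t - F t)) (Set.Icc 0 x) := by
    refine strictMonoOn_of_deriv_pos (convex_Icc 0 x)
      (Real.continuous_exp.continuousOn.mul (hf_cont.sub hF_cont)) fun t ht => ?_
    rw [interior_Icc] at ht
    have hderiv : HasDerivAt (fun t => Real.exp t * (f t - F t)) _ t :=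
      (Real.hasDerivAt_exp t).mul ((hf_deriv t ht).sub (hF_deriv t ht))
    rw [hderiv.deriv]
    have := mul_pos (Real.exp_pos t) (sub_pos.2 (tsum_besselCoeff_integral_lt_deriv hν ht.1))
    linarith
  have h := hmono (Set.left_mem_Icc.2 hx.le) (Set.right_mem_Icc.2 hx.le) hx
  simp only [hf_zero, hF_zero, sub_zero, mul_zero] at h
  exact sub_pos.1 (pos_of_mul_pos_right h (Real.exp_pos x).le)
end

section
/- For all real ν > -1/2, every real n ≥ 0, and all x > 0, ∫_0^x t^ν I_{ν+n}(t) dt < (2(ν+n+1)/(2ν+n+1)) x^ν I_{ν+n+1}(x). -/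
open Real MeasureTheory

/-- The `k`-th term of the power series of `besselI ν x`. -/
noncomputable def besselITerm (ν x : ℝ) (k : ℕ) : ℝ :=
  (1 / ((k.factorial : ℝ) * Real.Gamma ((k : ℝ) + ν + 1))) * (x / 2) ^ (2 * (k : ℝ) + ν)

lemma besselITerm_pos {ν x : ℝ} (hν : -1 < ν) (hx : 0 < x) (k : ℕ) :
    0 < besselITerm ν x k := by
  have hk : (0 : ℝ) ≤ k := k.cast_nonneg
  have hΓ : 0 < Real.Gamma ((k : ℝ) + ν + 1) := Real.Gamma_pos_of_pos (by linarith)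
  unfold besselITerm
  positivity

lemma Gamma_le_Gamma_natCast_add {ν : ℝ} (hν : 0 ≤ ν) (k : ℕ) :
    Real.Gamma (ν + 1) ≤ Real.Gamma ((k : ℝ) + ν + 1) := by
  induction k with
  | zero => simp
  | succ k ih =>
    have hk : (0 : ℝ) ≤ k := k.cast_nonneg
    have hpos : 0 < (k : ℝ) + ν + 1 := by linarith
    have hrec : Real.Gamma (((k + 1 : ℕ) : ℝ) + ν + 1) =
        ((k : ℝ) + ν + 1) * Real.Gamma ((k : ℝ) + ν + 1) := by
      rw [← Real.Gamma_add_one hpos.ne']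
      congr 1
      push_cast
      ring
    rw [hrec]
    exact ih.trans (le_mul_of_one_le_left (Real.Gamma_pos_of_pos hpos).le (by linarith))

lemma summable_besselITerm {ν x : ℝ} (hν : 0 ≤ ν) (hx : 0 < x) :
    Summable (besselITerm ν x) := by
  refine Summable.of_nonneg_of_le (fun k => (besselITerm_pos (by linarith) hx k).le) (fun k => ?_)
    ((Real.summable_pow_div_factorial ((x / 2) ^ 2)).mul_right
      ((x / 2) ^ ν / Real.Gamma (ν + 1)))
  have hΓ : 0 < Real.Gamma (ν + 1) := Real.Gamma_pos_of_pos (by linarith)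
  have hpow : (x / 2) ^ (2 * (k : ℝ) + ν) = ((x / 2) ^ 2) ^ k * (x / 2) ^ ν := by
    rw [Real.rpow_add (by positivity), ← pow_mul, ← Real.rpow_natCast]
    push_cast
    rfl
  rw [besselITerm, hpow, div_mul_div_comm, one_div_mul_eq_div]
  gcongr
  exact Gamma_le_Gamma_natCast_add hν k

lemma rpow_mul_besselITerm (ν μ : ℝ) {t : ℝ} (ht : 0 < t) (k : ℕ) :
    t ^ ν * besselITerm μ t k = besselITerm μ 1 k * t ^ (2 * (k : ℝ) + μ + ν) := by
  rw [besselITerm, besselITerm, Real.div_rpow ht.le (by norm_num),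
    Real.div_rpow zero_le_one (by norm_num), Real.one_rpow, Real.rpow_add ht _ ν]
  ring

lemma besselITerm_add_one {μ : ℝ} (hμ : -1 < μ) {x : ℝ} (hx : 0 < x) (k : ℕ) :
    besselITerm (μ + 1) x k = besselITerm μ x k * x / (2 * ((k : ℝ) + μ + 1)) := by
  have hpos : 0 < (k : ℝ) + μ + 1 := by linarith [k.cast_nonneg (α := ℝ)]
  have hΓ := Real.Gamma_pos_of_pos hpos
  rw [besselITerm, besselITerm, ← add_assoc, ← add_assoc, Real.Gamma_add_one hpos.ne',
    Real.rpow_add_one (by positivity)]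
  field_simp

lemma integrableOn_rpow_mul_besselITerm {ν μ : ℝ} (hνμ : -1 < μ + ν) (x : ℝ) (k : ℕ) :
    IntegrableOn (fun t => t ^ ν * besselITerm μ t k) (Set.Ioc 0 x) := by
  have hexp : -1 < 2 * (k : ℝ) + μ + ν := by linarith [k.cast_nonneg (α := ℝ)]
  refine IntegrableOn.congr_fun (f := fun t => besselITerm μ 1 k * t ^ (2 * (k : ℝ) + μ + ν))
    ?_ (fun t ht => (rpow_mul_besselITerm ν μ ht.1 k).symm) measurableSet_Ioc
  exact ((intervalIntegral.intervalIntegrable_rpow' (a := 0) (b := x) hexp).1).const_mul _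

lemma setIntegral_rpow_mul_besselITerm {ν μ : ℝ} (hνμ : -1 < μ + ν) {x : ℝ} (hx : 0 < x)
    (k : ℕ) :
    ∫ t in Set.Ioc 0 x, t ^ ν * besselITerm μ t k =
      x ^ ν * besselITerm μ x k * x / (2 * (k : ℝ) + μ + ν + 1) := by
  have hexp : -1 < 2 * (k : ℝ) + μ + ν := by linarith [k.cast_nonneg (α := ℝ)]
  rw [setIntegral_congr_fun measurableSet_Ioc
      (fun t ht => rpow_mul_besselITerm ν μ ht.1 k), integral_const_mul,
    ← intervalIntegral.integral_of_le hx.le, integral_rpow (Or.inl hexp),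
    Real.zero_rpow (by linarith), rpow_mul_besselITerm ν μ hx k, Real.rpow_add_one hx.ne']
  ring

theorem integral_besselI_shift_upper_bound (ν : ℝ) (hν : -(1 / 2) < ν) (n : ℝ) (hn : 0 ≤ n)
    (x : ℝ) (hx : 0 < x) :
    (∫ t in (0 : ℝ)..x, t ^ ν * besselI (ν + n) t) <
      (2 * (ν + n + 1) / (2 * ν + n + 1)) * x ^ ν * besselI (ν + n + 1) x := by
  have hk (k : ℕ) : (0 : ℝ) ≤ k := k.cast_nonneg
  have hμ : -1 < ν + n := by linarith
  have hνμ : -1 < ν + n + ν := by linarith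
  have hden : 0 < 2 * ν + n + 1 := by linarith
  have hpos {t : ℝ} (ht : 0 < t) (k : ℕ) : 0 < t ^ ν * besselITerm (ν + n) t k :=
    mul_pos (Real.rpow_pos_of_pos ht ν) (besselITerm_pos hμ ht k)
  let f (k : ℕ) : ℝ := ∫ t in Set.Ioc 0 x, t ^ ν * besselITerm (ν + n) t k
  let g (k : ℕ) : ℝ :=
    (2 * (ν + n + 1) / (2 * ν + n + 1)) * x ^ ν * besselITerm (ν + n + 1) x k
  have hg : HasSum g
      ((2 * (ν + n + 1) / (2 * ν + n + 1)) * x ^ ν * besselI (ν + n + 1) x) :=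
    (summable_besselITerm (by linarith) hx).hasSum.mul_left _
  have hdiff (k : ℕ) : g k - f k = x ^ ν * besselITerm (ν + n) x k * x * (k * (n + 1)) /
      ((2 * ν + n + 1) * (k + (ν + n) + 1) * (2 * k + (ν + n) + ν + 1)) := by
    have h₁ : 0 < (k : ℝ) + (ν + n) + 1 := by linarith [hk k]
    have h₂ : 0 < 2 * (k : ℝ) + (ν + n) + ν + 1 := by linarith [hk k]
    simp only [f, g]
    rw [setIntegral_rpow_mul_besselITerm hνμ hx, besselITerm_add_one hμ hx]
    field_simp
    ring
  have hfg (k : ℕ) : f k ≤ g k := by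
    have h₁ : 0 < (k : ℝ) + (ν + n) + 1 := by linarith [hk k]
    have h₂ : 0 < 2 * (k : ℝ) + (ν + n) + ν + 1 := by linarith [hk k]
    have := hpos hx k
    rw [← sub_nonneg, hdiff]
    positivity
  have hfg_one : f 1 < g 1 := by
    have h₁ : 0 < ((1 : ℕ) : ℝ) + (ν + n) + 1 := by linarith [hk 1]
    have h₂ : 0 < 2 * ((1 : ℕ) : ℝ) + (ν + n) + ν + 1 := by linarith [hk 1]
    have := hpos hx 1
    rw [← sub_pos, hdiff]
    positivity
  have hf_nonneg (k : ℕ) : 0 ≤ f k :=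
    setIntegral_nonneg measurableSet_Ioc fun t ht => (hpos ht.1 k).le
  have hf_summable : Summable f := hg.summable.of_nonneg_of_le hf_nonneg hfg
  have hnorm (k : ℕ) : ∫ t in Set.Ioc 0 x, ‖t ^ ν * besselITerm (ν + n) t k‖ = f k :=
    setIntegral_congr_fun measurableSet_Ioc fun t ht => Real.norm_of_nonneg (hpos ht.1 k).le
  have hf : HasSum f (∫ t in (0 : ℝ)..x, t ^ ν * besselI (ν + n) t) := by
    have h := hasSum_integral_of_summable_integral_norm
      (fun k => integrableOn_rpow_mul_besselITerm hνμ x k)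
      (hf_summable.congr fun k => (hnorm k).symm)
    simp only [tsum_mul_left] at h
    rw [intervalIntegral.integral_of_le hx.le]
    exact h
  exact hasSum_lt hfg hfg_one hf hg
end

section
/- On the interval (0,∞), the function x ↦ K_{ν-1}(x)/K_ν(x) is strictly monotone increasing if ν > 1/2, is constant if ν = 1/2, and is strictly monotone decreasing if ν < 1/2. -/
open Real MeasureTheory

/-- The modified Bessel function of the second kind
`K_ν(x) = ∫_0^∞ e^{-x cosh t} cosh(ν t) dt`. -/
noncomputable def besselK (ν x : ℝ) : ℝ :=
  ∫ t in Set.Ioi (0 : ℝ), Real.exp (-x * Real.cosh t) * Real.cosh (ν * t)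

/-- If `|μ| < |ν|`, then `cosh (μ s) / cosh (ν s)` is strictly decreasing in `|s|`. -/
theorem cosh_mul_cosh_lt_of_abs_lt {μ ν s t : ℝ} (hμν : |μ| < |ν|) (hst : |s| < |t|) :
    Real.cosh (μ * t) * Real.cosh (ν * s) < Real.cosh (μ * s) * Real.cosh (ν * t) := by
  have cosh_abs_mul (a b : ℝ) : Real.cosh (|a| * |b|) = Real.cosh (a * b) := by
    rw [← abs_mul, Real.cosh_abs]
  rw [← cosh_abs_mul μ t, ← cosh_abs_mul ν s, ← cosh_abs_mul μ s, ← cosh_abs_mul ν t]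
  have hμ := abs_nonneg μ
  have hs := abs_nonneg s
  generalize |μ| = m at *
  generalize |ν| = n at *
  generalize |s| = a at *
  generalize |t| = b at *
  have hab : 0 < (n - m) * (b - a) := mul_pos (sub_pos.2 hμν) (sub_pos.2 hst)
  have hadd : Real.cosh (n * a + m * b) < Real.cosh (n * b + m * a) := by
    rw [Real.cosh_lt_cosh, abs_of_nonneg (by nlinarith [mul_nonneg hμ hs]),
      abs_of_nonneg (by nlinarith [mul_nonneg hμ hs])]
    linarith
  have hsub : Real.cosh (n * a - m * b) < Real.cosh (n * b - m * a) := by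
    have hpos : 0 < (n + m) * (b - a) := mul_pos (by linarith) (sub_pos.2 hst)
    have hneg : 0 < (n - m) * (b + a) := mul_pos (sub_pos.2 hμν) (by linarith)
    rw [Real.cosh_lt_cosh]
    refine lt_of_lt_of_le (abs_lt.2 ⟨?_, ?_⟩) (le_abs_self _) <;> linarith
  rw [Real.cosh_add, Real.cosh_add] at hadd
  rw [Real.cosh_sub, Real.cosh_sub] at hsub
  linarith

theorem integrableOn_exp_neg_mul_cosh_mul_cosh (ν : ℝ) {x : ℝ} (hx : 0 < x) :
    IntegrableOn (fun t => Real.exp (-x * Real.cosh t) * Real.cosh (ν * t)) (Set.Ioi 0) := by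
  have hgauss : Integrable (fun t : ℝ => Real.exp (-(x / 4) * t ^ 2 + |ν| * t)) := by
    have h := (integrable_cexp_quadratic (b := ((x / 4 : ℝ) : ℂ))
      (by rw [Complex.ofReal_re]; positivity) ((|ν| : ℝ) : ℂ) 0).norm
    refine h.congr (Filter.Eventually.of_forall fun t => ?_)
    simp only [Complex.norm_exp]
    congr 1
    norm_cast
    simp
  refine hgauss.integrableOn.mono' (by fun_prop) ?_
  filter_upwards [ae_restrict_mem measurableSet_Ioi] with t ht
  have ht0 : 0 ≤ t := le_of_lt ht
  have hquad := Real.quadratic_le_exp_of_nonneg ht0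
  have hcosh : t ^ 2 / 4 ≤ Real.cosh t := by
    rw [Real.cosh_eq]
    linarith [Real.exp_pos (-t)]
  have hexp : Real.cosh (ν * t) ≤ Real.exp (|ν| * t) := by
    rw [← Real.cosh_abs, abs_mul, abs_of_nonneg ht0, ← Real.cosh_add_sinh]
    linarith [Real.sinh_nonneg_iff.2 (mul_nonneg (abs_nonneg ν) ht0)]
  rw [Real.norm_of_nonneg (mul_nonneg (Real.exp_pos _).le (Real.cosh_pos _).le), Real.exp_add]
  refine mul_le_mul (Real.exp_le_exp.2 ?_) hexp (Real.cosh_pos _).le (Real.exp_pos _).le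
  nlinarith

theorem besselK_pos (ν : ℝ) {x : ℝ} (hx : 0 < x) : 0 < besselK ν x := by
  have hpos (t : ℝ) : 0 < Real.exp (-x * Real.cosh t) * Real.cosh (ν * t) :=
    mul_pos (Real.exp_pos _) (Real.cosh_pos _)
  refine (integral_pos_iff_support_of_nonneg (fun t => (hpos t).le)
    (integrableOn_exp_neg_mul_cosh_mul_cosh ν hx)).2 ?_
  rw [Function.support_eq_univ fun t => (hpos t).ne']
  simp

/-- If `|μ| < |ν|`, then `K_μ / K_ν` is strictly increasing on `(0, ∞)`, in cross-multiplied form. -/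
theorem besselK_mul_besselK_lt {μ ν x y : ℝ} (hμν : |μ| < |ν|) (hx : 0 < x) (hxy : x < y) :
    besselK μ x * besselK ν y < besselK μ y * besselK ν x := by
  set f : ℝ → ℝ → ℝ → ℝ := fun κ z t => Real.exp (-z * Real.cosh t) * Real.cosh (κ * t) with hf
  set m : Measure ℝ := volume.restrict (Set.Ioi 0) with hm
  have hf_int (κ : ℝ) {z : ℝ} (hz : 0 < z) : Integrable (f κ z) m :=
    integrableOn_exp_neg_mul_cosh_mul_cosh κ hz
  have hy := hx.trans hxy
  have h₁ := (hf_int μ hy).mul_prod (hf_int ν hx)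
  have h₂ := (hf_int μ hx).mul_prod (hf_int ν hy)
  have h₃ := (hf_int ν hx).mul_prod (hf_int μ hy)
  have h₄ := (hf_int ν hy).mul_prod (hf_int μ hx)
  set G : ℝ × ℝ → ℝ := fun p => f μ y p.1 * f ν x p.2 - f μ x p.1 * f ν y p.2 +
    (f ν x p.1 * f μ y p.2 - f ν y p.1 * f μ x p.2) with hG
  have hG_int : Integrable G (m.prod m) := (h₁.sub h₂).add (h₃.sub h₄)
  have hG_eq : ∫ p, G p ∂(m.prod m) =
      2 * (besselK μ y * besselK ν x - besselK μ x * besselK ν y) := by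
    have hK (κ z : ℝ) : ∫ t, f κ z t ∂m = besselK κ z := rfl
    refine (integral_add (h₁.sub h₂) (h₃.sub h₄)).trans ?_
    rw [integral_sub' h₁ h₂, integral_sub' h₃ h₄]
    simp only [integral_prod_mul, hK]
    ring
  have hG_factor (p : ℝ × ℝ) : G p =
      (Real.exp (-y * Real.cosh p.1 + -x * Real.cosh p.2) -
        Real.exp (-x * Real.cosh p.1 + -y * Real.cosh p.2)) *
      (Real.cosh (μ * p.1) * Real.cosh (ν * p.2) - Real.cosh (μ * p.2) * Real.cosh (ν * p.1)) := by
    simp only [hG, hf, Real.exp_add]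
    ring
  have hG_pos (p : ℝ × ℝ) (hp : |p.1| ≠ |p.2|) : 0 < G p := by
    rw [hG_factor]
    rcases lt_or_gt_of_ne hp with h | h
    · refine mul_pos (sub_pos.2 (Real.exp_lt_exp.2 ?_))
        (sub_pos.2 (cosh_mul_cosh_lt_of_abs_lt hμν h))
      nlinarith [Real.cosh_lt_cosh.2 h]
    · refine mul_pos_of_neg_of_neg (sub_neg.2 (Real.exp_lt_exp.2 ?_))
        (sub_neg.2 (cosh_mul_cosh_lt_of_abs_lt hμν h))
      nlinarith [Real.cosh_lt_cosh.2 h]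
  have hG_nonneg : 0 ≤ G := fun p => by
    by_cases hp : |p.1| = |p.2|
    · rw [hG_factor, ← Real.cosh_abs p.1, ← Real.cosh_abs p.2, hp]
      simp [add_comm]
    · exact (hG_pos p hp).le
  have hG_supp : Set.Ioo (0 : ℝ) 1 ×ˢ Set.Ioo (1 : ℝ) 2 ⊆ Function.support G := by
    rintro ⟨s, t⟩ ⟨⟨hs0, hs1⟩, ht1, -⟩
    refine (hG_pos _ ?_).ne'
    simp only at hs0 hs1 ht1 ⊢
    rw [abs_of_pos hs0, abs_of_pos (by linarith)]
    exact (hs1.trans ht1).ne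
  have hbox : 0 < (m.prod m) (Set.Ioo (0 : ℝ) 1 ×ˢ Set.Ioo (1 : ℝ) 2) := by
    rw [Measure.prod_prod, hm, Measure.restrict_eq_self _ Set.Ioo_subset_Ioi_self,
      Measure.restrict_eq_self _ (Set.Ioo_subset_Ioi_self.trans
        (Set.Ioi_subset_Ioi zero_le_one)), Real.volume_Ioo, Real.volume_Ioo]
    norm_num
  have := (integral_pos_iff_support_of_nonneg hG_nonneg hG_int).2
    (hbox.trans_le (measure_mono hG_supp))
  linarith


theorem besselK_ratio_monotonicity (ν : ℝ) :
    (1 / 2 < ν → StrictMonoOn (fun x => besselK (ν - 1) x / besselK ν x) (Set.Ioi 0)) ∧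
    (ν = 1 / 2 → ∀ x ∈ Set.Ioi (0 : ℝ), ∀ y ∈ Set.Ioi (0 : ℝ),
      besselK (ν - 1) x / besselK ν x = besselK (ν - 1) y / besselK ν y) ∧
    (ν < 1 / 2 → StrictAntiOn (fun x => besselK (ν - 1) x / besselK ν x) (Set.Ioi 0)) := by
  refine ⟨fun hν x hx y hy hxy => ?_, fun hν x hx y hy => ?_, fun hν x hx y hy hxy => ?_⟩
  · have habs : |ν - 1| < |ν| := sq_lt_sq.1 (by nlinarith)
    exact (div_lt_div_iff₀ (besselK_pos ν hx) (besselK_pos ν hy)).2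
      (besselK_mul_besselK_lt habs hx hxy)
  · have hsymm (z : ℝ) : besselK (ν - 1) z = besselK ν z := by
      have hneg : ν - 1 = -ν := by linarith
      simp only [besselK, hneg, neg_mul ν, Real.cosh_neg]
    rw [hsymm, hsymm, div_self (besselK_pos ν hx).ne', div_self (besselK_pos ν hy).ne']
  · have habs : |ν| < |ν - 1| := sq_lt_sq.1 (by nlinarith)
    refine (div_lt_div_iff₀ (besselK_pos ν hy) (besselK_pos ν hx)).2 ?_
    linarith [besselK_mul_besselK_lt habs hx hxy]
end

section
/- For all x > 0: if ν > 1/2 then Δ_ν(x) < Δ_{ν-1}(x); Δ_{1/2}(x) = Δ_{-1/2}(x); and if ν < 1/2 then Δ_ν(x) > Δ_{ν-1}(x). -/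
open Real MeasureTheory

/-- The Turánian `Δ_ν(x) = K_ν(x)² − K_{ν-1}(x) K_{ν+1}(x)`. -/
noncomputable def turanian (ν x : ℝ) : ℝ :=
  besselK ν x ^ 2 - besselK (ν - 1) x * besselK (ν + 1) x

/-- The integrand of `besselK`. -/
noncomputable def besselKIntegrand (x ν t : ℝ) : ℝ :=
  Real.exp (-x * Real.cosh t) * Real.cosh (ν * t)

theorem besselK_eq_integral (ν x : ℝ) :
    besselK ν x = ∫ t in Set.Ioi (0 : ℝ), besselKIntegrand x ν t := rfl

theorem besselK_neg (ν x : ℝ) : besselK (-ν) x = besselK ν x := by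
  simp [besselK, neg_mul, Real.cosh_neg]

theorem turanian_neg (ν x : ℝ) : turanian (-ν) x = turanian ν x := by
  have h₁ : besselK (-ν - 1) x = besselK (ν + 1) x := by
    rw [← besselK_neg (ν + 1), neg_add']
  have h₂ : besselK (-ν + 1) x = besselK (ν - 1) x := by
    rw [← besselK_neg (ν - 1), neg_sub', sub_neg_eq_add]
  rw [turanian, turanian, besselK_neg, h₁, h₂, mul_comm (besselK (ν + 1) x)]

theorem cosh_le_exp_abs (y : ℝ) : Real.cosh y ≤ Real.exp |y| := by
  rw [← Real.cosh_abs, Real.cosh_eq]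
  have : Real.exp (-|y|) ≤ Real.exp |y| :=
    Real.exp_le_exp.2 (by linarith [abs_nonneg y])
  linarith

theorem sq_div_four_le_cosh {t : ℝ} (ht : 0 ≤ t) : t ^ 2 / 4 ≤ Real.cosh t := by
  rw [Real.cosh_eq]
  linarith [Real.quadratic_le_exp_of_nonneg ht, Real.exp_pos (-t)]

theorem integrable_besselKIntegrand {x : ℝ} (hx : 0 < x) (ν : ℝ) :
    Integrable (besselKIntegrand x ν) (volume.restrict (Set.Ioi (0 : ℝ))) := by
  have hdom : IntegrableOn (fun t : ℝ => Real.exp ((|ν| + 1) ^ 2 / x) * Real.exp (-t))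
      (Set.Ioi (0 : ℝ)) := (integrableOn_exp_neg_Ioi 0).const_mul _
  refine Integrable.mono' hdom ?_ ?_
  · unfold besselKIntegrand
    exact Continuous.aestronglyMeasurable (by fun_prop)
  · filter_upwards [ae_restrict_mem measurableSet_Ioi] with t ht
    have ht : 0 < t := ht
    rw [besselKIntegrand, Real.norm_of_nonneg (by positivity)]
    calc Real.exp (-x * Real.cosh t) * Real.cosh (ν * t)
        ≤ Real.exp (-x * Real.cosh t) * Real.exp |ν * t| := by
          gcongr
          exact cosh_le_exp_abs _
      _ ≤ Real.exp ((|ν| + 1) ^ 2 / x) * Real.exp (-t) := by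
          rw [← Real.exp_add, ← Real.exp_add, Real.exp_le_exp, abs_mul, abs_of_pos ht]
          have h₁ := mul_le_mul_of_nonneg_left (sq_div_four_le_cosh ht.le) hx.le
          have h₂ : (|ν| + 1) ^ 2 / x - (|ν| + 1) * t + x * (t ^ 2 / 4)
              = ((|ν| + 1) - x * t / 2) ^ 2 / x := by
            field_simp
            ring
          have h₃ : 0 ≤ ((|ν| + 1) - x * t / 2) ^ 2 / x := by positivity
          linarith

/-- The integrand of the symmetrized double integral representing the Turánian. -/
noncomputable def turanianIntegrand (x ν : ℝ) (z : ℝ × ℝ) : ℝ :=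
  besselKIntegrand x ν z.1 * besselKIntegrand x ν z.2 -
    (besselKIntegrand x (ν - 1) z.1 * besselKIntegrand x (ν + 1) z.2 +
      besselKIntegrand x (ν + 1) z.1 * besselKIntegrand x (ν - 1) z.2) / 2

theorem integrable_turanianIntegrand {x : ℝ} (hx : 0 < x) (ν : ℝ) :
    Integrable (turanianIntegrand x ν)
      ((volume.restrict (Set.Ioi (0 : ℝ))).prod (volume.restrict (Set.Ioi (0 : ℝ)))) := by
  have h (a : ℝ) := integrable_besselKIntegrand hx a
  exact ((h _).mul_prod (h _)).sub
    ((((h _).mul_prod (h _)).add ((h _).mul_prod (h _))).div_const 2)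

theorem turanian_eq_integral {x : ℝ} (hx : 0 < x) (ν : ℝ) :
    turanian ν x = ∫ z, turanianIntegrand x ν z
      ∂((volume.restrict (Set.Ioi (0 : ℝ))).prod (volume.restrict (Set.Ioi (0 : ℝ)))) := by
  have h (a b : ℝ) :=
    (integrable_besselKIntegrand hx a).mul_prod (integrable_besselKIntegrand hx b)
  unfold turanianIntegrand
  rw [integral_sub (h ν ν) (Integrable.div_const
      (Integrable.fun_add (h (ν - 1) (ν + 1)) (h (ν + 1) (ν - 1))) 2), integral_div,
    integral_add (h _ _) (h _ _), integral_prod_mul, integral_prod_mul, integral_prod_mul]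
  simp only [← besselK_eq_integral, turanian]
  ring

theorem turanianIntegrand_eq (x ν s t : ℝ) :
    turanianIntegrand x ν (s, t) =
      -(Real.exp (-x * Real.cosh s) * Real.exp (-x * Real.cosh t) / 2 *
        (Real.cosh (ν * (s + t)) * (Real.cosh (s - t) - 1) +
          Real.cosh (ν * (s - t)) * (Real.cosh (s + t) - 1))) := by
  simp only [turanianIntegrand, besselKIntegrand, mul_add, mul_sub, sub_mul, add_mul, one_mul,
    Real.cosh_add, Real.cosh_sub, mul_one]
  ring

theorem turanianIntegrand_le {x a b : ℝ} (hab : |b| ≤ |a|) (z : ℝ × ℝ) :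
    turanianIntegrand x a z ≤ turanianIntegrand x b z := by
  obtain ⟨s, t⟩ := z
  have hcosh (u : ℝ) : Real.cosh (b * u) ≤ Real.cosh (a * u) := by
    rw [Real.cosh_le_cosh, abs_mul, abs_mul]
    gcongr
  rw [turanianIntegrand_eq, turanianIntegrand_eq, neg_le_neg_iff]
  have h₁ : 0 ≤ Real.cosh (s - t) - 1 := sub_nonneg.2 (Real.one_le_cosh _)
  have h₂ : 0 ≤ Real.cosh (s + t) - 1 := sub_nonneg.2 (Real.one_le_cosh _)
  gcongr <;> exact hcosh _

theorem turanianIntegrand_lt {x a b s t : ℝ} (hab : |b| < |a|) (hsub : s - t ≠ 0)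
    (hadd : s + t ≠ 0) : turanianIntegrand x a (s, t) < turanianIntegrand x b (s, t) := by
  have hcosh {u : ℝ} (hu : u ≠ 0) : Real.cosh (b * u) < Real.cosh (a * u) := by
    rw [Real.cosh_lt_cosh, abs_mul, abs_mul]
    have := abs_pos.2 hu
    gcongr
  rw [turanianIntegrand_eq, turanianIntegrand_eq, neg_lt_neg_iff]
  have h₁ : 0 < Real.cosh (s - t) - 1 := sub_pos.2 (Real.one_lt_cosh.2 hsub)
  have h₂ : 0 < Real.cosh (s + t) - 1 := sub_pos.2 (Real.one_lt_cosh.2 hadd)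
  have h₃ := mul_lt_mul_of_pos_right (hcosh hadd) h₁
  have h₄ := mul_lt_mul_of_pos_right (hcosh hsub) h₂
  exact mul_lt_mul_of_pos_left (add_lt_add h₃ h₄) (by positivity)

theorem turanian_lt_of_abs_lt {x a b : ℝ} (hx : 0 < x) (hab : |b| < |a|) :
    turanian a x < turanian b x := by
  have ha := integrable_turanianIntegrand hx a
  have hb := integrable_turanianIntegrand hx b
  rw [turanian_eq_integral hx, turanian_eq_integral hx, ← sub_pos, ← integral_sub hb ha,
    integral_pos_iff_support_of_nonneg
      (fun z => sub_nonneg.2 (turanianIntegrand_le hab.le z)) (hb.sub ha)]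
  have hsub : Set.Ioo (0 : ℝ) 1 ×ˢ Set.Ioo (1 : ℝ) 2 ⊆
      Function.support (fun z => turanianIntegrand x b z - turanianIntegrand x a z) := by
    rintro ⟨s, t⟩ ⟨⟨hs₀, hs₁⟩, ⟨ht₁, -⟩⟩
    dsimp only at hs₀ hs₁ ht₁
    exact (sub_pos.2 (turanianIntegrand_lt hab (by linarith : s - t < 0).ne
      (by linarith : 0 < s + t).ne')).ne'
  refine lt_of_lt_of_le ?_ (measure_mono hsub)
  rw [Measure.prod_prod, Measure.restrict_apply measurableSet_Ioo,
    Measure.restrict_apply measurableSet_Ioo,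
    Set.inter_eq_left.2 Set.Ioo_subset_Ioi_self,
    Set.inter_eq_left.2
      (Set.Ioo_subset_Ioi_self.trans (Set.Ioi_subset_Ioi zero_le_one)), Real.volume_Ioo, Real.volume_Ioo]
  norm_num

theorem turanian_monotonicity (ν x : ℝ) (hx : 0 < x) :
    (1 / 2 < ν → turanian ν x < turanian (ν - 1) x) ∧
    turanian (1 / 2) x = turanian (-(1 / 2)) x ∧
    (ν < 1 / 2 → turanian (ν - 1) x < turanian ν x) := by
  refine ⟨fun h => turanian_lt_of_abs_lt hx ?_, (turanian_neg _ _).symm,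
    fun h => turanian_lt_of_abs_lt hx ?_⟩ <;>
  · rw [← sq_lt_sq]
    linarith [sub_sq ν 1]
end

section
/- For all real ν < 1/2, all real β with -1 < β < 1, and all x > 0, ∫_x^∞ e^{βt} t^ν K_ν(t) dt < (1/(1-|β|)) e^{βx} x^ν K_ν(x). -/
open Real MeasureTheory

/-- A doubly exponential weight beats any exponential. -/
lemma exp_neg_mul_cosh_mul_exp_le {t : ℝ} (ht : 0 < t) (a : ℝ) {u : ℝ} (hu : 0 ≤ u) :
    Real.exp (-t * Real.cosh u) * Real.exp (a * u) ≤
      Real.exp ((a + 1) ^ 2 / t) * Real.exp (-u) := by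
  rw [← Real.exp_add, ← Real.exp_add, Real.exp_le_exp]
  have h1 : u ^ 2 / 4 ≤ Real.cosh u := by
    have h := Real.quadratic_le_exp_of_nonneg hu
    have h' := Real.exp_pos (-u)
    rw [Real.cosh_eq]
    linarith
  have h2 : t * (u ^ 2 / 4) ≤ t * Real.cosh u := by gcongr
  have h3 : 0 ≤ (t * u / 2 - (a + 1)) ^ 2 / t := by positivity
  have h4 : (t * u / 2 - (a + 1)) ^ 2 / t =
      t * (u ^ 2 / 4) - (a + 1) * u + (a + 1) ^ 2 / t := by
    field_simp
    ring
  linarith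

lemma cosh_mul_le_exp_abs_mul (a : ℝ) {u : ℝ} (hu : 0 ≤ u) :
    Real.cosh (a * u) ≤ Real.exp (|a| * u) := by
  have h1 : Real.exp (a * u) ≤ Real.exp (|a| * u) :=
    Real.exp_le_exp.2 (mul_le_mul_of_nonneg_right (le_abs_self a) hu)
  have h2 : Real.exp (-(a * u)) ≤ Real.exp (|a| * u) := by
    rw [← neg_mul]
    exact Real.exp_le_exp.2 (mul_le_mul_of_nonneg_right (neg_le_abs a) hu)
  rw [Real.cosh_eq]
  linarith

lemma integrableOn_exp_neg_mul_cosh_mul {t : ℝ} (ht : 0 < t) (a : ℝ) {g : ℝ → ℝ}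
    (hg : Continuous g) (hga : ∀ u, 0 ≤ u → |g u| ≤ Real.exp (a * u)) :
    IntegrableOn (fun u => Real.exp (-t * Real.cosh u) * g u) (Set.Ioi 0) := by
  refine Integrable.mono' ((integrableOn_exp_neg_Ioi 0).const_mul (Real.exp ((a + 1) ^ 2 / t)))
    (by fun_prop) ?_
  filter_upwards [ae_restrict_mem measurableSet_Ioi] with u hu
  have hu' : 0 ≤ u := le_of_lt hu
  rw [norm_mul, Real.norm_eq_abs, Real.norm_eq_abs, Real.abs_exp]
  exact (mul_le_mul_of_nonneg_left (hga u hu') (Real.exp_pos _).le).trans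
    (exp_neg_mul_cosh_mul_exp_le ht a hu')

lemma integrableOn_besselK {t : ℝ} (ht : 0 < t) (ν : ℝ) :
    IntegrableOn (fun u => Real.exp (-t * Real.cosh u) * Real.cosh (ν * u)) (Set.Ioi 0) :=
  integrableOn_exp_neg_mul_cosh_mul ht |ν| (by fun_prop) fun u hu => by
    rw [abs_of_pos (Real.cosh_pos _)]
    exact cosh_mul_le_exp_abs_mul ν hu

lemma cosh_mul_cosh_mul_le_exp (ν : ℝ) {u : ℝ} (hu : 0 ≤ u) :
    Real.cosh u * Real.cosh (ν * u) ≤ Real.exp ((1 + |ν|) * u) := by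
  have h1 := cosh_mul_le_exp_abs_mul 1 hu
  have h2 := cosh_mul_le_exp_abs_mul ν hu
  rw [abs_one, one_mul] at h1
  rw [add_mul, Real.exp_add, one_mul]
  exact mul_le_mul h1 h2 (Real.cosh_pos _).le (Real.exp_pos _).le

lemma integrableOn_besselK_deriv {t : ℝ} (ht : 0 < t) (ν : ℝ) :
    IntegrableOn (fun u => Real.exp (-t * Real.cosh u) * (Real.cosh u * Real.cosh (ν * u)))
      (Set.Ioi 0) :=
  integrableOn_exp_neg_mul_cosh_mul ht (1 + |ν|) (by fun_prop) fun u hu => by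
    rw [abs_of_pos (mul_pos (Real.cosh_pos _) (Real.cosh_pos _))]
    exact cosh_mul_cosh_mul_le_exp ν hu

lemma abs_sinh_le_cosh (x : ℝ) : |Real.sinh x| ≤ Real.cosh x := by
  refine abs_le_of_sq_le_sq ?_ (Real.cosh_pos x).le
  rw [Real.cosh_sq]
  linarith

lemma integrableOn_exp_neg_mul_cosh_mul_sinh_mul_sinh {t : ℝ} (ht : 0 < t) (ν : ℝ) :
    IntegrableOn (fun u => Real.exp (-t * Real.cosh u) * (Real.sinh u * Real.sinh (ν * u)))
      (Set.Ioi 0) :=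
  integrableOn_exp_neg_mul_cosh_mul ht (1 + |ν|) (by fun_prop) fun u hu => by
    rw [abs_mul]
    exact (mul_le_mul (abs_sinh_le_cosh _) (abs_sinh_le_cosh _) (abs_nonneg _)
      (Real.cosh_pos _).le).trans (cosh_mul_cosh_mul_le_exp ν hu)

lemma setIntegral_Ioi_pos {a : ℝ} {g : ℝ → ℝ} (hg : IntegrableOn g (Set.Ioi a))
    (hpos : ∀ u ∈ Set.Ioi a, 0 < g u) : 0 < ∫ u in Set.Ioi a, g u := by
  rw [setIntegral_pos_iff_support_of_nonneg_ae _ hg]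
  · have h : Function.support g ∩ Set.Ioi a = Set.Ioi a :=
      Set.inter_eq_right.2 fun u hu => (hpos u hu).ne'
    rw [h, Real.volume_Ioi]
    exact ENNReal.zero_lt_top
  · filter_upwards [ae_restrict_mem measurableSet_Ioi] with u hu using (hpos u hu).le

lemma besselK_pos_s12 (ν : ℝ) {t : ℝ} (ht : 0 < t) : 0 < besselK ν t :=
  setIntegral_Ioi_pos (integrableOn_besselK ht ν) fun _ _ =>
    mul_pos (Real.exp_pos _) (Real.cosh_pos _)

lemma besselK_lt_besselK {μ ν t : ℝ} (ht : 0 < t) (h : |μ| < |ν|) :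
    besselK μ t < besselK ν t := by
  rw [← sub_pos, besselK, besselK,
    ← integral_sub (integrableOn_besselK ht ν) (integrableOn_besselK ht μ)]
  refine setIntegral_Ioi_pos ((integrableOn_besselK ht ν).sub (integrableOn_besselK ht μ)) ?_
  intro u hu
  rw [← mul_sub]
  refine mul_pos (Real.exp_pos _) (sub_pos.2 (Real.cosh_lt_cosh.2 ?_))
  rw [abs_mul, abs_mul]
  exact mul_lt_mul_of_pos_right h (abs_pos.2 (ne_of_gt hu))

lemma hasDerivAt_besselK (ν : ℝ) {t : ℝ} (ht : 0 < t) :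
    HasDerivAt (besselK ν)
      (-∫ u in Set.Ioi (0 : ℝ), Real.exp (-t * Real.cosh u) * (Real.cosh u * Real.cosh (ν * u)))
      t := by
  rw [← integral_neg]
  refine (hasDerivAt_integral_of_dominated_loc_of_deriv_le
    (F := fun s u => Real.exp (-s * Real.cosh u) * Real.cosh (ν * u))
    (F' := fun s u => -(Real.exp (-s * Real.cosh u) * (Real.cosh u * Real.cosh (ν * u))))
    (bound := fun u => Real.exp (-(t / 2) * Real.cosh u) * (Real.cosh u * Real.cosh (ν * u)))
    (Ioi_mem_nhds (half_lt_self ht)) (Filter.Eventually.of_forall fun s => by fun_prop)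
    (integrableOn_besselK ht ν) (by fun_prop) (Filter.Eventually.of_forall fun u s hs => ?_)
    (integrableOn_besselK_deriv (half_pos ht) ν)
    (Filter.Eventually.of_forall fun u s _ => ?_)).2
  · have hc := Real.cosh_pos u
    have hc' := Real.cosh_pos (ν * u)
    have hs' : t / 2 < s := hs
    rw [norm_neg, Real.norm_of_nonneg (by positivity)]
    gcongr
  · have h := ((((hasDerivAt_id s).neg).mul_const (Real.cosh u)).exp).mul_const (Real.cosh (ν * u))
    refine h.congr_deriv ?_
    simp only [id, Pi.neg_apply]
    ring

/-- Integration by parts in the integral representation. -/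
lemma mul_besselK_eq (ν : ℝ) {t : ℝ} (ht : 0 < t) :
    ν * besselK ν t =
      t * ∫ u in Set.Ioi (0 : ℝ),
        Real.exp (-t * Real.cosh u) * (Real.sinh u * Real.sinh (ν * u)) := by
  have hi1 := (integrableOn_besselK ht ν).const_mul ν
  have hi2 := (integrableOn_exp_neg_mul_cosh_mul_sinh_mul_sinh ht ν).const_mul t
  have hd : ∀ u ∈ Set.Ici (0 : ℝ),
      HasDerivAt (fun u => Real.exp (-t * Real.cosh u) * Real.sinh (ν * u))
        (ν * (Real.exp (-t * Real.cosh u) * Real.cosh (ν * u)) -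
          t * (Real.exp (-t * Real.cosh u) * (Real.sinh u * Real.sinh (ν * u)))) u := by
    intro u _
    have h1 := ((Real.hasDerivAt_cosh u).const_mul (-t)).exp
    have h2 := ((hasDerivAt_id u).const_mul ν).sinh
    refine (h1.mul h2).congr_deriv ?_
    simp only [id]
    ring
  have hlim : Filter.Tendsto (fun u => Real.exp (-t * Real.cosh u) * Real.sinh (ν * u))
      Filter.atTop (nhds 0) := by
    have h0 : Filter.Tendsto (fun u => Real.exp ((|ν| + 1) ^ 2 / t) * Real.exp (-u))
        Filter.atTop (nhds 0) := by
      simpa using Real.tendsto_exp_neg_atTop_nhds_zero.const_mul (Real.exp ((|ν| + 1) ^ 2 / t))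
    refine squeeze_zero_norm' ?_ h0
    filter_upwards [Filter.eventually_ge_atTop 0] with u hu
    rw [norm_mul, Real.norm_eq_abs, Real.norm_eq_abs, Real.abs_exp]
    exact (mul_le_mul_of_nonneg_left
      ((abs_sinh_le_cosh _).trans (cosh_mul_le_exp_abs_mul ν hu)) (Real.exp_pos _).le).trans
      (exp_neg_mul_cosh_mul_exp_le ht |ν| hu)
  have h := integral_Ioi_of_hasDerivAt_of_tendsto' hd (hi1.sub hi2) hlim
  rw [integral_sub hi1 hi2, integral_const_mul, integral_const_mul, mul_zero, Real.sinh_zero,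
    mul_zero, sub_zero, sub_eq_zero] at h
  exact h

lemma hasDerivAt_rpow_mul_besselK (ν : ℝ) {t : ℝ} (ht : 0 < t) :
    HasDerivAt (fun s => s ^ ν * besselK ν s) (-(t ^ ν * besselK (1 - ν) t)) t := by
  refine ((Real.hasDerivAt_rpow_const (p := ν) (Or.inl ht.ne')).mul
    (hasDerivAt_besselK ν ht)).congr_deriv ?_
  have h1 : besselK (1 - ν) t =
      (∫ u in Set.Ioi (0 : ℝ),
        Real.exp (-t * Real.cosh u) * (Real.cosh u * Real.cosh (ν * u))) -
      ∫ u in Set.Ioi (0 : ℝ),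
        Real.exp (-t * Real.cosh u) * (Real.sinh u * Real.sinh (ν * u)) := by
    rw [← integral_sub (integrableOn_besselK_deriv ht ν)
      (integrableOn_exp_neg_mul_cosh_mul_sinh_mul_sinh ht ν), besselK]
    congr 1 with u
    rw [sub_mul, one_mul, Real.cosh_sub]
    ring
  have h2 := mul_besselK_eq ν ht
  rw [mul_comm t, ← div_eq_iff ht.ne'] at h2
  rw [h1, Real.rpow_sub_one ht.ne']
  linear_combination t ^ ν * h2

lemma strictAntiOn_exp_mul_rpow_mul_besselK {ν : ℝ} (hν : ν < 1 / 2) :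
    StrictAntiOn (fun t => Real.exp t * (t ^ ν * besselK ν t)) (Set.Ioi 0) := by
  have hd : ∀ t : ℝ, 0 < t → HasDerivAt (fun t => Real.exp t * (t ^ ν * besselK ν t))
      (Real.exp t * (t ^ ν * (besselK ν t - besselK (1 - ν) t))) t := fun t ht =>
    ((Real.hasDerivAt_exp t).mul (hasDerivAt_rpow_mul_besselK ν ht)).congr_deriv (by ring)
  refine strictAntiOn_of_deriv_neg (convex_Ioi 0)
    (fun t ht => (hd t ht).continuousAt.continuousWithinAt) fun t ht => ?_
  rw [interior_Ioi] at ht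
  have ht' : 0 < t := ht
  rw [(hd t ht').deriv]
  have hlt : besselK ν t < besselK (1 - ν) t :=
    besselK_lt_besselK ht' (sq_lt_sq.1 (by nlinarith))
  exact mul_neg_of_pos_of_neg (Real.exp_pos _)
    (mul_neg_of_pos_of_neg (Real.rpow_pos_of_pos ht' _) (sub_neg.2 hlt))

theorem integral_exp_besselK_lt (ν β : ℝ) (hν : ν < 1 / 2) (hβ1 : -1 < β) (hβ2 : β < 1)
    (x : ℝ) (hx : 0 < x) :
    (∫ t in Set.Ioi x, Real.exp (β * t) * t ^ ν * besselK ν t) <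
      (1 / (1 - |β|)) * Real.exp (β * x) * x ^ ν * besselK ν x := by
  set f : ℝ → ℝ := fun t => Real.exp t * (t ^ ν * besselK ν t) with hf
  have hfpos : ∀ t, 0 < t → 0 < f t := fun t ht =>
    mul_pos (Real.exp_pos _) (mul_pos (Real.rpow_pos_of_pos ht _) (besselK_pos_s12 ν ht))
  have hF : ∀ t, Real.exp (β * t) * t ^ ν * besselK ν t = Real.exp ((β - 1) * t) * f t := by
    intro t
    rw [hf, ← mul_assoc, ← Real.exp_add, mul_assoc]
    congr 2
    ring
  have hlt : ∀ t ∈ Set.Ioi x, Real.exp ((β - 1) * t) * f t < Real.exp ((β - 1) * t) * f x :=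
    fun t ht => mul_lt_mul_of_pos_left
      (strictAntiOn_exp_mul_rpow_mul_besselK hν hx (hx.trans ht) ht) (Real.exp_pos _)
  have hG : IntegrableOn (fun t => Real.exp ((β - 1) * t) * f x) (Set.Ioi x) :=
    (integrableOn_exp_mul_Ioi (by linarith) x).mul_const _
  have hfc : ContinuousOn f (Set.Ioi x) := fun t ht =>
    (Real.continuous_exp.continuousAt.mul
      (hasDerivAt_rpow_mul_besselK ν (hx.trans ht)).continuousAt).continuousWithinAt
  have hFi : IntegrableOn (fun t => Real.exp ((β - 1) * t) * f t) (Set.Ioi x) := by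
    refine Integrable.mono' hG
      (ContinuousOn.aestronglyMeasurable (by fun_prop) measurableSet_Ioi) ?_
    filter_upwards [ae_restrict_mem measurableSet_Ioi] with t ht
    rw [Real.norm_of_nonneg (mul_pos (Real.exp_pos _) (hfpos t (hx.trans ht))).le]
    exact (hlt t ht).le
  have hint := setIntegral_Ioi_pos (hG.sub hFi) fun t ht => sub_pos.2 (hlt t ht)
  simp only [Pi.sub_apply] at hint
  rw [integral_sub hG hFi, sub_pos, integral_mul_const,
    integral_exp_mul_Ioi (by linarith)] at hint
  have habs : |β| < 1 := abs_lt.2 ⟨hβ1, hβ2⟩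
  simp only [mul_assoc, hF] at hint ⊢
  refine hint.trans_le ?_
  have heq : -Real.exp ((β - 1) * x) / (β - 1) * f x =
      1 / (1 - β) * (Real.exp ((β - 1) * x) * f x) := by
    rw [← neg_sub 1 β, neg_div_neg_eq]
    ring
  rw [heq]
  have hp := mul_pos (Real.exp_pos ((β - 1) * x)) (hfpos x hx)
  refine mul_le_mul_of_nonneg_right ?_ hp.le
  exact one_div_le_one_div_of_le (by linarith) (by linarith [le_abs_self β])
end
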